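/- Let S = s_1 s_2 ⋯ s_n be a sequence over Σ ∪ Σ' and let w : Σ → {1,…,M} be a weight function, extended to Σ' by w(σ') = w(σ). Define Ŝ = s_1^{w(s_1)} ∘ s_2^{w(s_2)} ∘ ⋯ ∘ s_n^{w(s_n)}, i.e., each symbol s_i is repeated w(s_i) times; Ŝ has length at most M·n. Then the unweighted RNA folding score of Ŝ equals the weighted RNA folding score of S: RNA(Ŝ) = WRNA(S). -/

import Mathlib

/-!
Formalization of (weighted) RNA folding from
"If the Current Clique Algorithms are Optimal, so is Valiant's Parser"
(Abboud, Backurs, Vassilevska Williams), Section 3.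

Letters come from `Σ ∪ Σ'`, modelled as `σ ⊕ σ`: `Sum.inl a` is the letter `a ∈ Σ` and
`Sum.inr a` is its matching letter `a' ∈ Σ'`.
-/

namespace RNAFolding

/-- Letters `x` and `y` match iff `y = x'` or `x = y'`. -/
def LMatches {σ : Type*} : σ ⊕ σ → σ ⊕ σ → Prop
  | .inl a, .inr b => a = b
  | .inr a, .inl b => a = b
  | _, _ => False

/-- Two pairs of indices `(i₁,j₁)`, `(i₂,j₂)` with `i₁<j₁` and `i₂<j₂` "cross" iff they share an
index, or `i₁<i₂<j₁<j₂`, or `i₂<i₁<j₂<j₁`. -/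
def Crosses (p q : ℕ × ℕ) : Prop :=
  p.1 = q.1 ∨ p.1 = q.2 ∨ p.2 = q.1 ∨ p.2 = q.2 ∨
    (p.1 < q.1 ∧ q.1 < p.2 ∧ p.2 < q.2) ∨ (q.1 < p.1 ∧ p.1 < q.2 ∧ q.2 < p.2)

/-- `A` is a valid folding of `S`: every pair `(i,j) ∈ A` satisfies `i < j < |S|` and the letters
`S[i]`, `S[j]` match, and no two pairs of `A` cross. -/
def IsFolding {σ : Type*} (S : List (σ ⊕ σ)) (A : Finset (ℕ × ℕ)) : Prop :=
  (∀ p ∈ A, p.1 < p.2 ∧ p.2 < S.length ∧ ∃ x ∈ S[p.1]?, ∃ y ∈ S[p.2]?, LMatches x y) ∧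
    ∀ p ∈ A, ∀ q ∈ A, p ≠ q → ¬ Crosses p q

/-- The weighted RNA folding score `WRNA(S)`: the maximum of `∑_{(i,j) ∈ A} w(S[i])` over all
valid foldings `A` of `S` (with the weight function extended to `Σ'` by `w(σ') = w(σ)`). -/
noncomputable def WRNA {σ : Type*} (w : σ → ℕ) (S : List (σ ⊕ σ)) : ℕ :=
  sSup {m | ∃ A : Finset (ℕ × ℕ),
    IsFolding S A ∧ ∑ p ∈ A, (S.map (Sum.elim w w)).getD p.1 0 = m}

/-- The (unweighted) RNA folding score `RNA(S)`: the maximum number of non-crossing matching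
pairs, i.e. the weighted score with all weights equal to `1`. -/
noncomputable def RNA {σ : Type*} (S : List (σ ⊕ σ)) : ℕ := WRNA (fun _ => 1) S

open Finset in
lemma hall_part {ε : Type*} [DecidableEq ε] (E : Finset ε) (l r : ε → ℕ) (k : ℕ)
    (hl : ∀ i, (E.filter (fun e => l e = i)).card ≤ k)
    (hr : ∀ i, (E.filter (fun e => r e = i)).card ≤ k) :
    ∃ T ⊆ E, Set.InjOn l T ∧ Set.InjOn r T ∧ E.card ≤ k * T.card := by
  classical
  rcases E.eq_empty_or_nonempty with rfl | hne
  · exact ⟨∅, by simp⟩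
  have hk : 0 < k := by
    obtain ⟨e, he⟩ := hne
    refine lt_of_lt_of_le (card_pos.2 ⟨e, ?_⟩) (hl (l e))
    simp [he]
  set L := E.image l with hL
  have hEL : E.card ≤ k * L.card := card_le_mul_card_image E k (fun a _ => hl a)
  obtain ⟨d, hd1, hd2⟩ : ∃ d, k * d ≤ k * L.card - E.card ∧ k * L.card - E.card < k * (d + 1) :=
    ⟨(k * L.card - E.card) / k, Nat.mul_div_le _ _, Nat.lt_mul_div_succ _ hk⟩
  let t : {x // x ∈ L} → Finset (ℕ ⊕ ℕ) := fun x =>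
    ((E.filter (fun e => l e = x.1)).image r).disjSum (range d)
  have hall : ∀ s : Finset {x // x ∈ L}, s.card ≤ (s.biUnion t).card := by
    intro s
    rcases s.eq_empty_or_nonempty with rfl | ⟨x0, hx0⟩
    · simp
    let s' : Finset ℕ := s.image Subtype.val
    have hs' : s'.card = s.card := card_image_of_injective _ Subtype.val_injective
    have hs'L : s' ⊆ L := by
      intro x hx
      obtain ⟨y, _, rfl⟩ := mem_image.1 hx
      exact y.2
    let E1 := E.filter (fun e => l e ∈ s')
    let E2 := E.filter (fun e => l e ∉ s')
    have h12 : E1.card + E2.card = E.card := card_filter_add_card_filter_not _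
    have h1 : E1.card ≤ k * (E1.image r).card :=
      card_le_mul_card_image E1 k (fun a _ =>
        (card_le_card (filter_subset_filter _ (filter_subset _ _))).trans (hr a))
    have h2 : E2.card ≤ k * (E2.image l).card :=
      card_le_mul_card_image E2 k (fun a _ =>
        (card_le_card (filter_subset_filter _ (filter_subset _ _))).trans (hl a))
    have h3 : (E2.image l).card ≤ (L \ s').card := by
      apply card_le_card
      intro x hx
      obtain ⟨e, he, rfl⟩ := mem_image.1 hx
      have := mem_filter.1 he
      exact mem_sdiff.2 ⟨mem_image_of_mem _ this.1, this.2⟩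
    have h4 : (L \ s').card + s.card = L.card := by
      rw [← hs']; exact card_sdiff_add_card_eq_card hs'L
    have h5 : (E1.image r).card + d ≤ (s.biUnion t).card := by
      have : ((E1.image r).disjSum (range d)).card ≤ (s.biUnion t).card := by
        apply card_le_card
        intro y hy
        rcases mem_disjSum.1 hy with ⟨b, hb, rfl⟩ | ⟨b, hb, rfl⟩
        · obtain ⟨e, he, rfl⟩ := mem_image.1 hb
          obtain ⟨he1, he2⟩ := mem_filter.1 he
          obtain ⟨x, hx, hxe⟩ := mem_image.1 he2
          refine mem_biUnion.2 ⟨x, hx, inl_mem_disjSum.2 (mem_image_of_mem _ ?_)⟩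
          exact mem_filter.2 ⟨he1, hxe.symm⟩
        · exact mem_biUnion.2 ⟨x0, hx0, inr_mem_disjSum.2 hb⟩
      simpa [card_disjSum] using this
    refine le_trans ?_ h5
    have h6 : k * (E2.image l).card ≤ k * (L \ s').card := Nat.mul_le_mul_left _ h3
    have h7 : k * (L \ s').card + k * s.card = k * L.card := by rw [← mul_add, h4]
    have h8 : k * s.card < k * ((E1.image r).card + d + 1) := by
      have : k * ((E1.image r).card + d + 1) = k * (E1.image r).card + k * (d + 1) := by ring
      omega
    have := Nat.lt_of_mul_lt_mul_left h8
    omega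
  obtain ⟨f, hf, hft⟩ := (all_card_le_biUnion_card_iff_exists_injective t).1 hall
  have hg : ∀ x : {x // x ∈ L}, ∃ e ∈ E, l e = x.1 ∧ ∀ b, f x = Sum.inl b → r e = b := by
    intro x
    have := hft x
    rcases mem_disjSum.1 this with ⟨b, hb, hfb⟩ | ⟨b, hb, hfb⟩
    · obtain ⟨e, he, rfl⟩ := mem_image.1 hb
      obtain ⟨he1, he2⟩ := mem_filter.1 he
      refine ⟨e, he1, he2, fun b hb => ?_⟩
      rw [← hfb] at hb
      exact Sum.inl.inj hb
    · obtain ⟨e, he, hex⟩ := mem_image.1 x.2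
      refine ⟨e, he, hex, fun b' hb' => ?_⟩
      rw [← hfb] at hb'
      cases hb'
  choose g hgE hgl hgr using hg
  have hginj : Function.Injective g := fun x y h => Subtype.ext (by rw [← hgl, ← hgl, h])
  refine ⟨(univ.filter (fun x => (f x).isLeft)).image g, ?_, ?_, ?_, ?_⟩
  · intro e he
    obtain ⟨x, _, rfl⟩ := mem_image.1 he
    exact hgE x
  · intro e he e' he' h
    obtain ⟨x, _, rfl⟩ := mem_image.1 (mem_coe.1 he)
    obtain ⟨y, _, rfl⟩ := mem_image.1 (mem_coe.1 he')
    rw [hgl, hgl] at h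
    rw [Subtype.ext h]
  · intro e he e' he' h
    obtain ⟨x, hx, rfl⟩ := mem_image.1 (mem_coe.1 he)
    obtain ⟨y, hy, rfl⟩ := mem_image.1 (mem_coe.1 he')
    obtain ⟨b, hb⟩ := Sum.isLeft_iff.1 (mem_filter.1 hx).2
    obtain ⟨c, hc⟩ := Sum.isLeft_iff.1 (mem_filter.1 hy).2
    rw [hgr x b hb, hgr y c hc] at h
    rw [hf (hb.trans (h ▸ hc.symm))]
  · rw [card_image_of_injective _ hginj]
    have h1 := card_filter_add_card_filter_not (s := (univ : Finset {x // x ∈ L}))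
      (fun x => (f x).isLeft = true)
    have h2 : (univ.filter (fun x => ¬ (f x).isLeft = true)).card ≤ d := by
      have : ((univ.filter (fun x => ¬ (f x).isLeft = true)).image f).card ≤
          ((range d).image (Sum.inr : ℕ → ℕ ⊕ ℕ)).card := by
        apply card_le_card
        intro y hy
        obtain ⟨x, hx, rfl⟩ := mem_image.1 hy
        have hx := (mem_filter.1 hx).2
        rcases mem_disjSum.1 (hft x) with ⟨b, hb, hfb⟩ | ⟨b, hb, hfb⟩
        · rw [← hfb] at hx; simp at hx
        · rw [← hfb]; exact mem_image_of_mem _ hb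
      rw [card_image_of_injective _ hf, card_image_of_injective _ Sum.inr_injective,
        card_range] at this
      exact this
    have h3 : (univ : Finset {x // x ∈ L}).card = L.card := by simp
    rw [h3] at h1
    have h4 := Nat.mul_le_mul_left k h2
    have h5 := congrArg (fun z => k * z) h1
    simp only [mul_add] at h5
    omega

open Finset in
lemma hall_all {ε : Type*} [DecidableEq ε] (E : Finset ε) (l r : ε → ℕ) (W : ℕ → ℕ)
    (hW : ∀ e ∈ E, W (l e) = W (r e))
    (hl : ∀ i, (E.filter (fun e => l e = i)).card ≤ W i)
    (hr : ∀ i, (E.filter (fun e => r e = i)).card ≤ W i) :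
    ∃ T ⊆ E, Set.InjOn l T ∧ Set.InjOn r T ∧ E.card ≤ ∑ e ∈ T, W (l e) := by
  classical
  have key : ∀ k, ∃ T ⊆ E.filter (fun e => W (l e) = k), Set.InjOn l T ∧ Set.InjOn r T ∧
      (E.filter (fun e => W (l e) = k)).card ≤ k * T.card := by
    intro k
    apply hall_part
    · intro i
      by_cases hi : W i = k
      · exact (card_le_card (filter_subset_filter _ (filter_subset _ _))).trans (hi ▸ hl i)
      · rw [card_eq_zero.2]; · exact Nat.zero_le _
        grind
    · intro i
      by_cases hi : W i = k
      · exact (card_le_card (filter_subset_filter _ (filter_subset _ _))).trans (hi ▸ hr i)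
      · rw [card_eq_zero.2]; · exact Nat.zero_le _
        grind
  choose T hTE hTl hTr hTc using key
  have hT : ∀ k, ∀ e ∈ T k, e ∈ E ∧ W (l e) = k := fun k e he => mem_filter.1 (hTE k he)
  refine ⟨(E.image (fun e => W (l e))).biUnion T, ?_, ?_, ?_, ?_⟩
  · intro e he
    obtain ⟨k, _, h⟩ := mem_biUnion.1 he
    exact (hT k e h).1
  · intro e he e' he' h
    obtain ⟨k, _, hk⟩ := mem_biUnion.1 (mem_coe.1 he)
    obtain ⟨k', _, hk'⟩ := mem_biUnion.1 (mem_coe.1 he')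
    have : k = k' := by rw [← (hT k e hk).2, ← (hT k' e' hk').2, h]
    subst this
    exact hTl k hk hk' h
  · intro e he e' he' h
    obtain ⟨k, _, hk⟩ := mem_biUnion.1 (mem_coe.1 he)
    obtain ⟨k', _, hk'⟩ := mem_biUnion.1 (mem_coe.1 he')
    have : k = k' := by
      rw [← (hT k e hk).2, ← (hT k' e' hk').2, hW _ (hT k e hk).1, hW _ (hT k' e' hk').1, h]
    subst this
    exact hTr k hk hk' h
  · rw [sum_biUnion]
    · rw [card_eq_sum_card_image (fun e => W (l e)) E]
      apply sum_le_sum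
      intro k _
      refine (hTc k).trans ?_
      rw [sum_congr rfl (fun e he => (hT k e he).2), sum_const, smul_eq_mul, mul_comm]
    · intro k _ k' _ hkk
      refine disjoint_left.2 fun e he he' => hkk ?_
      rw [← (hT k e he).2, ← (hT k' e he').2]

/-- Weight of position `i`. -/
def wt {σ : Type*} (w : σ → ℕ) (S : List (σ ⊕ σ)) (i : ℕ) : ℕ :=
  (S.map (Sum.elim w w)).getD i 0

/-- Start of block `i`. -/
def st {σ : Type*} (w : σ → ℕ) (S : List (σ ⊕ σ)) (i : ℕ) : ℕ :=
  ∑ j ∈ Finset.range i, wt w S j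

/-- Expanded sequence. -/
abbrev hat {σ : Type*} (w : σ → ℕ) (S : List (σ ⊕ σ)) : List (σ ⊕ σ) :=
  S.flatMap (fun x => List.replicate (Sum.elim w w x) x)

lemma wt_of {σ : Type*} (w : σ → ℕ) (S : List (σ ⊕ σ)) (i : ℕ) (x : σ ⊕ σ)
    (h : S[i]? = some x) : wt w S i = Sum.elim w w x := by
  simp [wt, List.getD, h]

lemma st_succ {σ : Type*} (w : σ → ℕ) (S : List (σ ⊕ σ)) (i : ℕ) :
    st w S (i + 1) = st w S i + wt w S i := Finset.sum_range_succ _ _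

lemma st_mono {σ : Type*} (w : σ → ℕ) (S : List (σ ⊕ σ)) : Monotone (st w S) :=
  monotone_nat_of_le_succ fun i => by rw [st_succ]; omega

lemma st_cons {σ : Type*} (w : σ → ℕ) (x : σ ⊕ σ) (S : List (σ ⊕ σ)) (i : ℕ) :
    st w (x :: S) (i + 1) = Sum.elim w w x + st w S i := by
  unfold st
  rw [Finset.sum_range_succ', add_comm]
  simp [wt]

lemma hat_length {σ : Type*} (w : σ → ℕ) (S : List (σ ⊕ σ)) :
    (hat w S).length = st w S S.length := by
  induction S with
  | nil => simp [st]
  | cons x S ih =>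
    rw [List.length_cons, st_cons, ← ih]
    simp [hat]

lemma hat_get {σ : Type*} (w : σ → ℕ) (S : List (σ ⊕ σ)) (i k : ℕ) (hk : k < wt w S i) :
    (hat w S)[st w S i + k]? = S[i]? := by
  induction S generalizing i with
  | nil => simp [wt] at hk
  | cons x S ih =>
    cases i with
    | zero =>
      have hk' : k < Sum.elim w w x := by simpa [wt] using hk
      simp only [hat, List.flatMap_cons, st, Finset.range_zero, Finset.sum_empty, zero_add]
      rw [List.getElem?_append_left (by simpa using hk')]
      simp [hk']
    | succ i =>
      have hk' : k < wt w S i := by simpa [wt] using hk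
      rw [st_cons]
      simp only [hat, List.flatMap_cons]
      rw [List.getElem?_append_right (by simp; omega)]
      simp only [List.length_replicate, List.getElem?_cons_succ]
      rw [← ih i hk']
      congr 1
      omega

lemma blk_exists {σ : Type*} (w : σ → ℕ) (S : List (σ ⊕ σ)) (p : ℕ) :
    ∃ i, p < (hat w S).length → st w S i ≤ p ∧ p < st w S (i + 1) ∧ i < S.length := by
  by_cases hp : p < (hat w S).length
  · rw [hat_length] at hp
    have : ∀ n, p < st w S n → ∃ i, st w S i ≤ p ∧ p < st w S (i + 1) ∧ i < n := by
      intro n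
      induction n with
      | zero => intro h; simp [st] at h
      | succ n ih =>
        intro h
        by_cases h' : p < st w S n
        · obtain ⟨i, h1, h2, h3⟩ := ih h'
          exact ⟨i, h1, h2, by omega⟩
        · exact ⟨n, by omega, h, by omega⟩
    obtain ⟨i, hi⟩ := this _ hp
    exact ⟨i, fun _ => hi⟩
  · exact ⟨0, fun h => absurd h hp⟩

lemma lmatches_wt {σ : Type*} (w : σ → ℕ) {x y : σ ⊕ σ} (h : LMatches x y) :
    Sum.elim w w x = Sum.elim w w y := by
  rcases x with a | a <;> rcases y with b | b <;> simp_all [LMatches]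

lemma lmatches_left {σ : Type*} {x y : σ ⊕ σ} (h : LMatches x y) :
    x.isLeft = !y.isLeft := by
  rcases x with a | a <;> rcases y with b | b <;> simp_all [LMatches]

lemma bdd {σ : Type*} (w : σ → ℕ) (S : List (σ ⊕ σ)) :
    BddAbove {m | ∃ A : Finset (ℕ × ℕ),
      IsFolding S A ∧ ∑ p ∈ A, (S.map (Sum.elim w w)).getD p.1 0 = m} := by
  refine ⟨∑ p ∈ Finset.range S.length ×ˢ Finset.range S.length,
    (S.map (Sum.elim w w)).getD p.1 0, ?_⟩
  rintro m ⟨A, hA, rfl⟩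
  apply Finset.sum_le_sum_of_subset
  intro p hp
  have := hA.1 p hp
  simp only [Finset.mem_product, Finset.mem_range]
  omega

lemma le_WRNA {σ : Type*} (w : σ → ℕ) (S : List (σ ⊕ σ)) (A : Finset (ℕ × ℕ))
    (hA : IsFolding S A) : ∑ p ∈ A, wt w S p.1 ≤ WRNA w S :=
  le_csSup (bdd w S) ⟨A, hA, rfl⟩

lemma WRNA_le {σ : Type*} (w : σ → ℕ) (S : List (σ ⊕ σ)) (N : ℕ)
    (h : ∀ A, IsFolding S A → ∑ p ∈ A, wt w S p.1 ≤ N) : WRNA w S ≤ N := by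
  apply csSup_le
  · exact ⟨0, ∅, by simp [IsFolding], by simp⟩
  · rintro m ⟨A, hA, rfl⟩
    exact h A hA

lemma sum_one {σ : Type*} (S : List (σ ⊕ σ)) (A : Finset (ℕ × ℕ)) (hA : IsFolding S A) :
    ∑ p ∈ A, wt (fun _ => 1) S p.1 = A.card := by
  rw [Finset.card_eq_sum_ones]
  apply Finset.sum_congr rfl
  intro p hp
  obtain ⟨h1, h2, x, hx, y, hy, hxy⟩ := hA.1 p hp
  rw [wt_of _ S p.1 x hx]
  cases x <;> rfl

open Finset in
lemma dir_ge {σ : Type*} (w : σ → ℕ) (S : List (σ ⊕ σ)) (A : Finset (ℕ × ℕ))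
    (hA : IsFolding S A) :
    ∃ B, IsFolding (hat w S) B ∧ B.card = ∑ p ∈ A, wt w S p.1 := by
  classical
  let φ : (Σ _ : ℕ × ℕ, ℕ) → ℕ × ℕ := fun z =>
    (st w S z.1.1 + z.2, st w S z.1.2 + (wt w S z.1.2 - 1 - z.2))
  let D := A.sigma (fun p => range (wt w S p.1))
  have hw : ∀ p ∈ A, wt w S p.1 = wt w S p.2 := by
    intro p hp
    obtain ⟨h1, h2, x, hx, y, hy, hxy⟩ := hA.1 p hp
    rw [wt_of _ S p.1 x hx, wt_of _ S p.2 y hy, lmatches_wt w hxy]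
  have hD : ∀ z ∈ D, z.1 ∈ A ∧ z.2 < wt w S z.1.1 := by
    intro z hz
    simpa [D] using hz
  have lt : ∀ i j a b, i < j → a < wt w S i → st w S i + a < st w S j + b := by
    intro i j a b hij ha
    have := st_mono w S (Nat.succ_le_of_lt hij)
    rw [Nat.succ_eq_add_one, st_succ] at this
    omega
  have tri : ∀ i j a b, a < wt w S i → b < wt w S j →
      (i < j ∧ st w S i + a < st w S j + b) ∨ (j < i ∧ st w S j + b < st w S i + a) ∨ i = j := by
    intro i j a b ha hb
    rcases lt_trichotomy i j with h | h | h
    · exact Or.inl ⟨h, lt _ _ _ _ h ha⟩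
    · exact Or.inr (Or.inr h)
    · exact Or.inr (Or.inl ⟨h, lt _ _ _ _ h hb⟩)
  have nc : ∀ z ∈ D, ∀ z' ∈ D, z ≠ z' → ¬ Crosses (φ z) (φ z') := by
    rintro ⟨p, k⟩ hz ⟨q, m⟩ hz' hne
    obtain ⟨hp, hk⟩ := hD _ hz
    obtain ⟨hq, hm⟩ := hD _ hz'
    have wp := hw p hp
    have wq := hw q hq
    have lp := (hA.1 p hp).1
    have lq := (hA.1 q hq).1
    simp only at hp hk hq hm
    have t1 := tri p.1 q.1 k m hk hm
    have t2 := tri p.1 q.2 k (wt w S q.2 - 1 - m) hk (by omega)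
    have t3 := tri p.2 q.1 (wt w S p.2 - 1 - k) m (by omega) hm
    have t4 := tri p.2 q.2 (wt w S p.2 - 1 - k) (wt w S q.2 - 1 - m) (by omega) (by omega)
    by_cases hpq : p = q
    · subst hpq
      have hkm : k ≠ m := by rintro rfl; exact hne rfl
      simp only [Crosses, φ]
      omega
    · have := hA.2 p hp q hq hpq
      simp only [Crosses, φ] at this ⊢
      omega
  have inj : Set.InjOn φ D := by
    intro z hz z' hz' h
    by_contra hne
    exact nc z hz z' hz' hne (Or.inl (by rw [h]))
  refine ⟨D.image φ, ⟨?_, ?_⟩, ?_⟩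
  · intro e he
    obtain ⟨⟨p, k⟩, hz, rfl⟩ := mem_image.1 he
    obtain ⟨hp, hk⟩ := hD _ hz
    have wp := hw p hp
    obtain ⟨h1, h2, x, hx, y, hy, hxy⟩ := hA.1 p hp
    simp only at hp hk
    refine ⟨lt _ _ _ _ h1 hk, ?_, x, ?_, y, ?_, hxy⟩
    · rw [hat_length]
      exact lt p.2 S.length (wt w S p.2 - 1 - k) 0 h2 (by omega)
    · simp only [φ]; rw [hat_get _ _ _ _ hk]; exact hx
    · simp only [φ]; rw [hat_get _ _ _ _ (by omega)]; exact hy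
  · intro e he e' he' hne
    obtain ⟨z, hz, rfl⟩ := mem_image.1 he
    obtain ⟨z', hz', rfl⟩ := mem_image.1 he'
    exact nc z hz z' hz' (fun h => hne (by rw [h]))
  · rw [card_image_of_injOn inj]
    simp [D]

open Finset in
lemma dir_le {σ : Type*} (w : σ → ℕ) (S : List (σ ⊕ σ)) (B : Finset (ℕ × ℕ))
    (hB : IsFolding (hat w S) B) :
    ∃ A, IsFolding S A ∧ B.card ≤ ∑ p ∈ A, wt w S p.1 := by
  classical
  choose b hb using blk_exists w S
  have mono : ∀ p q, p < (hat w S).length → q < (hat w S).length → b p < b q → p < q := by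
    intro p q hp hq h
    have h1 := hb p hp
    have h2 := hb q hq
    have := st_mono w S (Nat.succ_le_of_lt h)
    rw [Nat.succ_eq_add_one] at this
    omega
  have get : ∀ p, p < (hat w S).length → (hat w S)[p]? = S[b p]? := by
    intro p hp
    obtain ⟨h1, h2, _⟩ := hb p hp
    rw [st_succ] at h2
    rw [← hat_get w S (b p) (p - st w S (b p)) (by omega)]
    congr 1
    omega
  let L : ℕ → Prop := fun i => ∃ x, S[i]? = some x ∧ x.isLeft = true
  have hE : ∀ e ∈ B, e.1 < e.2 ∧ e.1 < (hat w S).length ∧ e.2 < (hat w S).length ∧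
      (∃ x ∈ S[b e.1]?, ∃ y ∈ S[b e.2]?, LMatches x y) ∧ (L (b e.1) ↔ ¬ L (b e.2)) ∧
      wt w S (b e.1) = wt w S (b e.2) := by
    intro e he
    obtain ⟨h1, h2, x, hx, y, hy, hxy⟩ := hB.1 e he
    have h3 : e.1 < (hat w S).length := h1.trans h2
    rw [get _ h3] at hx
    rw [get _ h2] at hy
    refine ⟨h1, h3, h2, ⟨x, hx, y, hy, hxy⟩, ?_, ?_⟩
    · have hx' : S[b e.1]? = some x := hx
      have hy' : S[b e.2]? = some y := hy
      have := lmatches_left hxy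
      simp only [L, hx', hy', Option.some.injEq, exists_eq_left', this]
      simp
    · rw [wt_of w S _ x hx, wt_of w S _ y hy, lmatches_wt w hxy]
  let le : ℕ × ℕ → ℕ := fun e => if L (b e.1) then e.1 else e.2
  let re : ℕ × ℕ → ℕ := fun e => if L (b e.1) then e.2 else e.1
  have fib : ∀ f : ℕ × ℕ → ℕ, (∀ e, f e = e.1 ∨ f e = e.2) →
      ∀ i, (B.filter (fun e => b (f e) = i)).card ≤ wt w S i := by
    intro f hf i
    have h1 : wt w S i = (Ico (st w S i) (st w S (i + 1))).card := by
      rw [Nat.card_Ico, st_succ]; omega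
    rw [h1]
    apply card_le_card_of_injOn f
    · intro e he
      obtain ⟨he1, he2⟩ := mem_filter.1 (mem_coe.1 he)
      have h := hE e he1
      have hlt : f e < (hat w S).length := by
        rcases hf e with h' | h' <;> rw [h']
        exacts [h.2.1, h.2.2.1]
      have := hb _ hlt
      rw [he2] at this
      simp only [coe_Ico, Set.mem_Ico]
      exact ⟨this.1, this.2.1⟩
    · intro e he e' he' h
      by_contra hne
      apply hB.2 e (mem_filter.1 (mem_coe.1 he)).1 e' (mem_filter.1 (mem_coe.1 he')).1 hne
      have := hf e
      have := hf e'
      simp only [Crosses]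
      omega
  obtain ⟨T, hTB, hTl, hTr, hTc⟩ := hall_all B (fun e => b (le e)) (fun e => b (re e)) (wt w S)
    (by
      intro e he
      have := (hE e he).2.2.2.2.2
      simp only [le, re]
      split_ifs
      · exact this
      · exact this.symm)
    (fib le (by intro e; simp only [le]; split_ifs <;> simp))
    (fib re (by intro e; simp only [re]; split_ifs <;> simp))
  let ψ : ℕ × ℕ → ℕ × ℕ := fun e => (b e.1, b e.2)
  have nc : ∀ e ∈ T, ∀ e' ∈ T, e ≠ e' → ¬ Crosses (ψ e) (ψ e') := by
    intro e he e' he' hne hc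
    have h1 := hE e (hTB he)
    have h2 := hE e' (hTB he')
    have hl : b (le e) ≠ b (le e') := fun h => hne (hTl he he' h)
    have hr : b (re e) ≠ b (re e') := fun h => hne (hTr he he' h)
    have hn := hB.2 e (hTB he) e' (hTB he') hne
    obtain ⟨a1, a2, a3, -, a5, -⟩ := h1
    obtain ⟨c1, c2, c3, -, c5, -⟩ := h2
    simp only [le, re] at hl hr
    rcases hc with h | h | h | h | h | h
    · simp only [ψ] at h
      rw [h] at hl hr
      split_ifs at hl hr <;> simp_all
    · simp only [ψ] at h
      by_cases hL : L (b e'.1)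
      · have : ¬ L (b e.1) := by rw [h]; exact c5.1 hL
        simp only [hL, this, if_true, if_false] at hr
        exact hr h
      · have : L (b e.1) := by rw [h]; exact not_not.1 (fun h' => hL (c5.2 h'))
        simp only [hL, this, if_true, if_false] at hl
        exact hl h
    · simp only [ψ] at h
      by_cases hL : L (b e.1)
      · have : ¬ L (b e'.1) := by rw [← h]; exact a5.1 hL
        simp only [hL, this, if_true, if_false] at hr
        exact hr h
      · have : L (b e'.1) := by rw [← h]; exact not_not.1 (fun h' => hL (a5.2 h'))
        simp only [hL, this, if_true, if_false] at hl
        exact hl h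
    · simp only [ψ] at h
      have hiff : L (b e.1) ↔ L (b e'.1) := by rw [a5, c5, h]
      by_cases hL : L (b e.1)
      · simp only [hL, hiff.1 hL, if_true] at hr
        exact hr h
      · have : ¬ L (b e'.1) := fun h' => hL (hiff.2 h')
        simp only [hL, this, if_false] at hl
        exact hl h
    · apply hn
      refine Or.inr (Or.inr (Or.inr (Or.inr (Or.inl ⟨?_, ?_, ?_⟩))))
      · exact mono _ _ a2 c2 h.1
      · exact mono _ _ c2 a3 h.2.1
      · exact mono _ _ a3 c3 h.2.2
    · apply hn
      refine Or.inr (Or.inr (Or.inr (Or.inr (Or.inr ⟨?_, ?_, ?_⟩))))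
      · exact mono _ _ c2 a2 h.1
      · exact mono _ _ a2 c3 h.2.1
      · exact mono _ _ c3 a3 h.2.2
  have inj : Set.InjOn ψ T := by
    intro z hz z' hz' h
    by_contra hne
    exact nc z hz z' hz' hne (Or.inl (by rw [h]))
  refine ⟨T.image ψ, ⟨?_, ?_⟩, ?_⟩
  · intro p hp
    obtain ⟨e, he, rfl⟩ := mem_image.1 hp
    obtain ⟨a1, a2, a3, a4, a5, -⟩ := hE e (hTB he)
    refine ⟨?_, (hb _ a3).2.2, a4⟩
    simp only [ψ]
    rcases lt_trichotomy (b e.1) (b e.2) with h | h | h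
    · exact h
    · rw [h] at a5; exact absurd a5 (iff_not_self)
    · have := mono _ _ a3 a2 h; omega
  · intro e he e' he' hne
    obtain ⟨z, hz, rfl⟩ := mem_image.1 he
    obtain ⟨z', hz', rfl⟩ := mem_image.1 he'
    exact nc z hz z' hz' (fun h => hne (by rw [h]))
  · rw [sum_image inj]
    refine hTc.trans (le_of_eq (sum_congr rfl fun e he => ?_))
    have := (hE e (hTB he)).2.2.2.2.2
    simp only [le, ψ]
    split_ifs
    · rfl
    · exact this.symm

/-- Lemma 3.3 of the paper.
Let `S = s₁ ⋯ s_n` be a sequence over `Σ ∪ Σ'` and let `w : Σ → {1,…,M}` be a weight function,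
extended to `Σ'` by `w(σ') = w(σ)`. Define `Ŝ = s₁^{w(s₁)} ∘ ⋯ ∘ s_n^{w(s_n)}`, i.e., each
symbol `s_i` is repeated `w(s_i)` times; `Ŝ` has length at most `M·n`. Then the unweighted RNA
folding score of `Ŝ` equals the weighted RNA folding score of `S`: `RNA(Ŝ) = WRNA(S)`. -/
theorem rna_of_expansion_eq_wrna {σ : Type*} (M : ℕ) (w : σ → ℕ)
    (hw : ∀ a : σ, 1 ≤ w a ∧ w a ≤ M) (S : List (σ ⊕ σ)) :
    (S.flatMap (fun x => List.replicate (Sum.elim w w x) x)).length ≤ M * S.length ∧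
      RNA (S.flatMap (fun x => List.replicate (Sum.elim w w x) x)) = WRNA w S := by
  constructor
  · rw [List.length_flatMap]
    calc _ ≤ (S.map (fun x => (List.replicate (Sum.elim w w x) x).length)).length • M := by
          apply List.sum_le_card_nsmul
          intro n hn
          obtain ⟨x, _, rfl⟩ := List.mem_map.1 hn
          rw [List.length_replicate]
          cases x with
          | inl a => exact (hw a).2
          | inr a => exact (hw a).2
      _ = M * S.length := by simp [mul_comm]
  · apply le_antisymm
    · apply WRNA_le
      intro B hB
      rw [sum_one _ B hB]
      obtain ⟨A, hA, h⟩ := dir_le w S B hB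
      exact h.trans (le_WRNA w S A hA)
    · apply WRNA_le
      intro A hA
      obtain ⟨B, hB, h⟩ := dir_ge w S A hA
      rw [← h, ← sum_one _ B hB]
      exact le_WRNA _ _ B hB

end RNAFolding
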